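/- There is an absolute constant c > 0 such that for every positive integer k, every finite simple graph G with chromatic number χ(G) = k, and every real number d with 1 ≤ d ≤ k^{1/3}, the probability that the chromatic number of the random subgraph G_{1/2} is at most d satisfies P(χ(G_{1/2}) ≤ d) ≤ exp(−c·k·(k − d³)/d³). -/

import Mathlib

open scoped Classical

/-- Probability, for the random subgraph of `G` in which each edge of `G` is retained
independently with probability `p`, of the event `A`. -/
noncomputable def subgraphProb {V : Type} [Fintype V] (G : SimpleGraph V)
    (p : ℝ) (A : SimpleGraph V → Prop) : ℝ :=
  ∑ s ∈ G.edgeSet.toFinset.powerset,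
    (if A (SimpleGraph.fromEdgeSet ↑s) then
      p ^ s.card * (1 - p) ^ (G.edgeSet.toFinset.card - s.card) else 0)

/-- The cubic estimate behind the induction step for triples of families whose members
jointly miss many elements. -/
lemma prod_add_le_of_cross_bounds {a b c x y z L : ℝ} (hx : 0 ≤ x) (hy : 0 ≤ y) (hz : 0 ≤ z)
    (hxa : x ≤ a) (hyb : y ≤ b) (hzc : z ≤ c) (hL : 0 ≤ L)
    (h₁ : x * b * c ≤ L) (h₂ : a * y * c ≤ L) (h₃ : a * b * z ≤ L)
    (h : a * b * c ≤ 4 * L) :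
    (a + x) * (b + y) * (c + z) ≤ 8 * L := by
  have ha := hx.trans hxa
  have hb := hy.trans hyb
  have hc := hz.trans hzc
  obtain ⟨M, hM⟩ : ∃ M, M = a * b * c := ⟨_, rfl⟩
  rw [← hM] at h
  rcases le_or_gt M L with hML | hML
  · calc (a + x) * (b + y) * (c + z) ≤ (a + a) * (b + b) * (c + c) := by gcongr
      _ = 8 * M := by rw [hM]; ring
      _ ≤ 8 * L := by linarith
  · have hM0 : 0 < M := hL.trans_lt hML
    have hexp : M ^ 2 * ((a + x) * (b + y) * (c + z)) =
        (M + x * b * c) * (M + a * y * c) * (M + a * b * z) := by rw [hM]; ring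
    have hle : (M + x * b * c) * (M + a * y * c) * (M + a * b * z) ≤
        (M + L) * (M + L) * (M + L) := by gcongr
    have hcub : (M + L) * (M + L) * (M + L) ≤ M ^ 2 * (8 * L) := by
      nlinarith [mul_nonneg (sub_nonneg.2 hML.le) (mul_nonneg hM0.le (sub_nonneg.2 h)),
        mul_nonneg (sub_nonneg.2 hML.le) (mul_nonneg hL hL)]
    refine le_of_mul_le_mul_left ?_ (pow_pos hM0 2)
    rw [hexp]
    exact hle.trans hcub

/-- If three decreasing families of subsets of `E` are such that any choice of one member from
each leaves at least `t` elements of `E` uncovered, then the product of their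
densities is at most `exp (-t)`. -/
lemma card_mul_card_mul_card_le_of_uncovered {α : Type*} [DecidableEq α] (E : Finset α) :
    ∀ (A B C : Finset α → Prop) (t : ℝ), Antitone A → Antitone B → Antitone C →
      (∀ R ⊆ E, ∀ S ⊆ E, ∀ T ⊆ E, A R → B S → C T → t ≤ ((E \ (R ∪ S ∪ T)).card : ℝ)) →
      (∑ S ∈ E.powerset, if A S then (1 : ℝ) else 0) *
        (∑ S ∈ E.powerset, if B S then (1 : ℝ) else 0) *
        (∑ S ∈ E.powerset, if C S then (1 : ℝ) else 0) ≤ 8 ^ E.card * Real.exp (-t) := by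
  induction E using Finset.induction_on with
  | empty =>
    intro A B C t _ _ _ h
    have hpos := Real.exp_pos (-t)
    simp only [Finset.powerset_empty, Finset.sum_singleton]
    by_cases hA : A ∅ <;> by_cases hB : B ∅ <;> by_cases hC : C ∅ <;> simp [hA, hB, hC, hpos.le]
    have := h ∅ (by simp) ∅ (by simp) ∅ (by simp) hA hB hC
    simpa using this
  | insert e E he ih =>
    intro A B C t hA hB hC h
    have hanti : ∀ {P : Finset α → Prop}, Antitone P → Antitone fun S => P (insert e S) :=
      fun hP _ _ hST => hP (Finset.insert_subset_insert e hST)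
    have hnonneg : ∀ P : Finset α → Prop,
        0 ≤ ∑ S ∈ E.powerset, if P S then (1 : ℝ) else 0 := fun P =>
      Finset.sum_nonneg fun S _ => by split_ifs <;> norm_num
    have hle : ∀ {P : Finset α → Prop}, Antitone P →
        (∑ S ∈ E.powerset, if P (insert e S) then (1 : ℝ) else 0) ≤
          ∑ S ∈ E.powerset, if P S then (1 : ℝ) else 0 := by
      intro P hP
      refine Finset.sum_le_sum fun S _ => ?_
      have := hP (Finset.subset_insert e S)
      by_cases h₁ : P (insert e S)
      · simp [h₁, show P S from this h₁]
      · simp only [h₁, if_false]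
        split_ifs <;> norm_num
    have hsub : ∀ {S : Finset α}, S ⊆ E → S ⊆ insert e E := fun hS =>
      hS.trans (Finset.subset_insert e E)
    have hins : ∀ {S : Finset α}, S ⊆ E → insert e S ⊆ insert e E := fun hS =>
      Finset.insert_subset_insert e hS
    have hdiff : ∀ U : Finset α, insert e E \ insert e U = E \ U := by
      intro U
      ext v
      simp only [Finset.mem_sdiff, Finset.mem_insert]
      constructor
      · tauto
      · rintro ⟨hv, hU⟩
        exact ⟨Or.inr hv, fun h' => h'.elim (fun h'' => he (h'' ▸ hv)) hU⟩
    simp only [Finset.sum_powerset_insert he]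
    rw [Finset.card_insert_of_notMem he, pow_succ',
      mul_assoc 8 ((8 : ℝ) ^ E.card)]
    refine prod_add_le_of_cross_bounds (hnonneg _) (hnonneg _) (hnonneg _) (hle hA) (hle hB)
      (hle hC) (by positivity) ?_ ?_ ?_ ?_
    · refine ih (fun S => A (insert e S)) B C t (hanti hA) hB hC ?_
      intro R hR S hS T hT h₁ h₂ h₃
      have := h _ (hins hR) _ (hsub hS) _ (hsub hT) h₁ h₂ h₃
      rwa [Finset.insert_union, Finset.insert_union, hdiff] at this
    · refine ih A (fun S => B (insert e S)) C t hA (hanti hB) hC ?_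
      intro R hR S hS T hT h₁ h₂ h₃
      have := h _ (hsub hR) _ (hins hS) _ (hsub hT) h₁ h₂ h₃
      rwa [Finset.union_insert, Finset.insert_union, hdiff] at this
    · refine ih A B (fun S => C (insert e S)) t hA hB (hanti hC) ?_
      intro R hR S hS T hT h₁ h₂ h₃
      have := h _ (hsub hR) _ (hsub hS) _ (hins hT) h₁ h₂ h₃
      rwa [Finset.union_insert, hdiff] at this
    · refine (ih A B C (t - 1) hA hB hC ?_).trans ?_
      · intro R hR S hS T hT h₁ h₂ h₃
        have := h _ (hsub hR) _ (hsub hS) _ (hsub hT) h₁ h₂ h₃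
        have heU : e ∉ R ∪ S ∪ T := fun h' =>
          he (Finset.union_subset (Finset.union_subset hR hS) hT h')
        rw [Finset.insert_sdiff_of_notMem _ heU, Finset.card_insert_of_notMem
          (fun h' => he (Finset.mem_sdiff.1 h').1)] at this
        push_cast at this
        linarith
      · have h4 : Real.exp 1 ≤ 4 := by linarith [Real.exp_one_lt_d9]
        rw [show -(t - 1) = 1 + -t by ring, Real.exp_add]
        calc (8 : ℝ) ^ E.card * (Real.exp 1 * Real.exp (-t))
            ≤ 8 ^ E.card * (4 * Real.exp (-t)) := by gcongr
          _ = 4 * (8 ^ E.card * Real.exp (-t)) := by ring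

/-- A finite set containing all edges of a graph of chromatic number `n` has at least
`n.choose 2` elements. -/
lemma choose_two_le_card_of_edgeSet_subset {V : Type*} {H : SimpleGraph V} {n : ℕ}
    (hn : H.chromaticNumber = n) {F : Finset (Sym2 V)} (hF : H.edgeSet ⊆ F) :
    n.choose 2 ≤ F.card := by
  obtain ⟨C⟩ : H.Colorable n := SimpleGraph.chromaticNumber_le_iff_colorable.1 hn.le
  have hedge : ∀ i j : Fin n, i ≠ j → ∃ u v, H.Adj u v ∧ C u = i ∧ C v = j := by
    intro i j hij
    by_contra! hno
    let C' : H.Coloring {x : Fin n // x ≠ j} := SimpleGraph.Coloring.mk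
      (fun v => if hv : C v = j then ⟨i, hij⟩ else ⟨C v, hv⟩) (by
        intro u v huv heq
        have hne := C.valid huv
        by_cases hu : C u = j <;> by_cases hv : C v = j
        · exact hne (hu.trans hv.symm)
        · simp only [hu, hv, dite_true, dite_false, Subtype.mk.injEq] at heq
          exact hno v u huv.symm heq.symm hu
        · simp only [hu, hv, dite_true, dite_false, Subtype.mk.injEq] at heq
          exact hno u v huv heq hv
        · simp only [hu, hv, dite_false, Subtype.mk.injEq] at heq
          exact hne heq)
    have hle := C'.colorable.chromaticNumber_le
    rw [hn, Nat.cast_le, Fintype.card_subtype_compl, Fintype.card_fin,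
      Fintype.card_subtype_eq] at hle
    have := i.pos
    omega
  have hsub : (⊤ : SimpleGraph (Fin n)).edgeFinset ⊆ F.image (Sym2.map C) := by
    intro e he
    induction e using Sym2.ind with
    | _ i j =>
      obtain ⟨u, v, huv, hu, hv⟩ := hedge i j (by simpa using he)
      refine Finset.mem_image.2 ⟨s(u, v), hF huv, ?_⟩
      simp [hu, hv]
  have := (Finset.card_le_card hsub).trans Finset.card_image_le
  rwa [SimpleGraph.card_edgeFinset_top_eq_card_choose_two, Fintype.card_fin] at this

/-- In any vertex colouring of `G` with `D ≤ χ(G)` colours, there are at least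
`k (k - D) / (2 D)` monochromatic edges, where `k = χ(G)`. -/
lemma le_card_of_monochromatic_mem {V ι : Type*} [Fintype V] [Fintype ι] [Nonempty ι]
    (G : SimpleGraph V) {k : ℕ} (hk : G.chromaticNumber = k) (f : V → ι)
    (hD : Fintype.card ι ≤ k) (M : Finset (Sym2 V))
    (hM : ∀ u v, G.Adj u v → f u = f v → s(u, v) ∈ M) :
    (k : ℝ) * (k - Fintype.card ι) / (2 * Fintype.card ι) ≤ M.card := by
  obtain ⟨H, hH⟩ : ∃ H : ι → SimpleGraph V,
      ∀ i u v, (H i).Adj u v ↔ G.Adj u v ∧ f u = i ∧ f v = i :=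
    ⟨fun i =>
      { Adj := fun u v => G.Adj u v ∧ f u = i ∧ f v = i
        symm := ⟨fun _ _ h => ⟨h.1.symm, h.2.2, h.2.1⟩⟩
        loopless := ⟨fun _ h => h.1.ne rfl⟩ }, fun _ _ _ => Iff.rfl⟩
  have hfin : ∀ i, ∃ n : ℕ, (H i).chromaticNumber = n := fun i =>
    ⟨_, (ENat.natCast_toNat (SimpleGraph.chromaticNumber_ne_top_iff_exists.2
      ⟨_, (H i).colorable_of_fintype⟩)).symm⟩
  choose n hn using hfin
  have hcol : ∀ i, Nonempty ((H i).Coloring (Fin (n i))) := fun i =>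
    SimpleGraph.chromaticNumber_le_iff_colorable.1 (hn i).le
  have hksum : k ≤ ∑ i, n i := by
    let C : G.Coloring (Σ i, Fin (n i)) := SimpleGraph.Coloring.mk
      (fun v => ⟨f v, (hcol (f v)).some v⟩) (by
        intro u v huv heq
        obtain ⟨hf, hc⟩ := Sigma.mk.inj_iff.1 heq
        have hadj : (H (f u)).Adj u v := (hH _ _ _).2 ⟨huv, rfl, hf.symm⟩
        refine (hcol (f u)).some.valid hadj ?_
        rw [← hf] at hc
        exact eq_of_heq hc)
    have := C.colorable.chromaticNumber_le
    rw [hk, Nat.cast_le] at this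
    simpa using this
  obtain ⟨F, hF⟩ : ∃ F : ι → Finset (Sym2 V), ∀ i e, e ∈ F i ↔ e ∈ (H i).edgeSet :=
    ⟨fun i => {e | e ∈ (H i).edgeSet}, fun i e => by simp⟩
  have hcard : ∑ i, (n i).choose 2 ≤ M.card := by
    calc ∑ i, (n i).choose 2 ≤ ∑ i, (F i).card := Finset.sum_le_sum fun i _ =>
          choose_two_le_card_of_edgeSet_subset (hn i) fun e he => (hF i e).2 he
      _ = (Finset.univ.biUnion F).card := by
          refine (Finset.card_biUnion fun i _ j _ hij => ?_).symm
          rw [Function.onFun, Finset.disjoint_left]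
          intro e hi hj
          induction e using Sym2.ind with
          | _ u v =>
            rw [hF, SimpleGraph.mem_edgeSet, hH] at hi hj
            exact hij (hi.2.1.symm.trans hj.2.1)
      _ ≤ M.card := by
          refine Finset.card_le_card fun e he => ?_
          obtain ⟨i, -, hi⟩ := Finset.mem_biUnion.1 he
          induction e using Sym2.ind with
          | _ u v =>
            rw [hF, SimpleGraph.mem_edgeSet, hH] at hi
            exact hM u v hi.1 (hi.2.1.trans hi.2.2.symm)
  have hcardR : ∑ i, (n i : ℝ) * (n i - 1) / 2 ≤ M.card := by
    calc ∑ i, (n i : ℝ) * (n i - 1) / 2 = ((∑ i, (n i).choose 2 : ℕ) : ℝ) := by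
          push_cast
          exact Finset.sum_congr rfl fun i _ => (Nat.cast_choose_two ℝ (n i)).symm
      _ ≤ M.card := by exact_mod_cast hcard
  have hcs := sq_sum_le_card_mul_sum_sq (s := (Finset.univ : Finset ι)) (f := fun i => (n i : ℝ))
  have hkR : (k : ℝ) ≤ ∑ i, (n i : ℝ) := by exact_mod_cast hksum
  have hDR : (Fintype.card ι : ℝ) ≤ k := by exact_mod_cast hD
  have hD0 : (0 : ℝ) < Fintype.card ι := by exact_mod_cast Fintype.card_pos
  have hsum : ∑ i, (n i : ℝ) * (n i - 1) / 2 =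
      (∑ i, (n i : ℝ) ^ 2) / 2 - (∑ i, (n i : ℝ)) / 2 := by
    rw [Finset.sum_div, Finset.sum_div, ← Finset.sum_sub_distrib]
    exact Finset.sum_congr rfl fun i _ => by ring
  rw [hsum] at hcardR
  rw [Finset.card_univ] at hcs
  rw [div_le_iff₀ (by positivity)]
  nlinarith [mul_le_mul_of_nonneg_right hcardR hD0.le]

/-- A finite graph has chromatic number at most a real number `d ≥ 0` if and only if it is
`⌊d⌋`-colourable. -/
lemma chromaticNumber_toNat_le_iff_colorable_floor {V : Type*} [Fintype V] (H : SimpleGraph V)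
    {d : ℝ} (hd : 0 ≤ d) : (H.chromaticNumber.toNat : ℝ) ≤ d ↔ H.Colorable ⌊d⌋₊ := by
  have htop : H.chromaticNumber ≠ ⊤ :=
    SimpleGraph.chromaticNumber_ne_top_iff_exists.2 ⟨_, H.colorable_of_fintype⟩
  rw [← Nat.le_floor_iff hd, ← SimpleGraph.chromaticNumber_le_iff_colorable,
    ← ENat.natCast_le_natCast, ENat.natCast_toNat htop]

/-- If three subgraphs of `G`, with edge sets `R`, `S`, `T`, are `q`-colourable, then at least
`k (k - q³) / (2 q³)` edges of `G` lie outside `R ∪ S ∪ T`, where `k = χ(G)`. -/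
lemma le_card_edgeFinset_sdiff_of_colorable {V : Type*} [Fintype V] (G : SimpleGraph V)
    {k q : ℕ} (hk : G.chromaticNumber = k) (hq : 0 < q) (hqk : q ^ 3 ≤ k)
    {R S T : Finset (Sym2 V)} (hR : (SimpleGraph.fromEdgeSet (R : Set (Sym2 V))).Colorable q)
    (hS : (SimpleGraph.fromEdgeSet (S : Set (Sym2 V))).Colorable q)
    (hT : (SimpleGraph.fromEdgeSet (T : Set (Sym2 V))).Colorable q) :
    (k : ℝ) * (k - (q : ℝ) ^ 3) / (2 * (q : ℝ) ^ 3) ≤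
      ((G.edgeSet.toFinset \ (R ∪ S ∪ T)).card : ℝ) := by
  obtain ⟨CR⟩ := hR
  obtain ⟨CS⟩ := hS
  obtain ⟨CT⟩ := hT
  have : NeZero q := ⟨hq.ne'⟩
  have hcard : Fintype.card (Fin q × Fin q × Fin q) = q ^ 3 := by
    simp only [Fintype.card_prod, Fintype.card_fin]
    ring
  have := le_card_of_monochromatic_mem G hk (fun v => (CR v, CS v, CT v)) (hcard.le.trans hqk)
    (G.edgeSet.toFinset \ (R ∪ S ∪ T)) (by
      intro u v huv heq
      simp only [Prod.mk.injEq] at heq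
      have hnot : ∀ {U : Finset (Sym2 V)}
          (C : (SimpleGraph.fromEdgeSet (U : Set (Sym2 V))).Coloring (Fin q)),
          C u = C v → s(u, v) ∉ U := fun C hC hU =>
        C.valid ((SimpleGraph.fromEdgeSet_adj _).2 ⟨hU, huv.ne⟩) hC
      simp only [Finset.mem_sdiff, Set.mem_toFinset, SimpleGraph.mem_edgeSet, Finset.mem_union]
      have h₁ := hnot CR heq.1
      have h₂ := hnot CS heq.2.1
      have h₃ := hnot CT heq.2.2
      tauto)
  rw [hcard] at this
  exact_mod_cast this

/-- The probability of an event for the random subgraph with `p = 1/2` is its density. -/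
lemma subgraphProb_half {V : Type} [Fintype V] (G : SimpleGraph V) (A : SimpleGraph V → Prop) :
    subgraphProb G (1/2) A = (∑ S ∈ G.edgeSet.toFinset.powerset,
      if A (SimpleGraph.fromEdgeSet (S : Set (Sym2 V))) then (1 : ℝ) else 0) /
        2 ^ G.edgeSet.toFinset.card := by
  rw [subgraphProb, Finset.sum_div]
  refine Finset.sum_congr rfl fun S hS => ?_
  have hcard := Finset.card_le_card (Finset.mem_powerset.1 hS)
  split_ifs
  · rw [show (1 : ℝ) - 1 / 2 = 1 / 2 by norm_num, ← pow_add, Nat.add_sub_cancel' hcard,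
      one_div_pow]
  · rw [zero_div]

/-- If a decreasing event is such that any three of its members leave at least `t` edges of `G`
uncovered, then its probability for the random subgraph with `p = 1/2` is at most
`exp (-t / 3)`. -/
lemma subgraphProb_half_le_of_uncovered {V : Type} [Fintype V] (G : SimpleGraph V)
    {A : SimpleGraph V → Prop} (hA : Antitone A) {t : ℝ}
    (ht : ∀ R S T : Finset (Sym2 V), A (SimpleGraph.fromEdgeSet (R : Set (Sym2 V))) →
      A (SimpleGraph.fromEdgeSet (S : Set (Sym2 V))) →
      A (SimpleGraph.fromEdgeSet (T : Set (Sym2 V))) →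
      t ≤ ((G.edgeSet.toFinset \ (R ∪ S ∪ T)).card : ℝ)) :
    subgraphProb G (1/2) A ≤ Real.exp (-t / 3) := by
  have hanti : Antitone fun S : Finset (Sym2 V) =>
      A (SimpleGraph.fromEdgeSet (S : Set (Sym2 V))) := fun S T hST =>
    hA (SimpleGraph.fromEdgeSet_mono (Finset.coe_subset.2 hST))
  have hcube := card_mul_card_mul_card_le_of_uncovered G.edgeSet.toFinset _ _ _ t
    hanti hanti hanti fun R _ S _ T _ => ht R S T
  rw [subgraphProb_half]
  generalize (∑ S ∈ G.edgeSet.toFinset.powerset,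
    if A (SimpleGraph.fromEdgeSet (S : Set (Sym2 V))) then (1 : ℝ) else 0) = N at hcube ⊢
  generalize G.edgeSet.toFinset.card = m at hcube ⊢
  have hexp : Real.exp (-t / 3) ^ 3 = Real.exp (-t) := by
    rw [← Real.exp_nat_mul]
    congr 1
    push_cast
    ring
  have hpow : ((2 : ℝ) ^ m) ^ 3 = 8 ^ m := by
    rw [← pow_mul, mul_comm, pow_mul]
    norm_num
  refine le_of_pow_le_pow_left₀ three_ne_zero (Real.exp_pos _).le ?_
  rw [hexp, div_pow, hpow, div_le_iff₀ (by positivity), pow_three', mul_comm (Real.exp _)]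
  exact hcube

/-- For a graph `G` with chromatic number `k` and `1 ≤ d ≤ k^{1/3}`,
`P(χ(G_{1/2}) ≤ d) ≤ exp (-c k (k - d³) / d³)` for an absolute constant `c > 0`. -/
theorem chromatic_lower_tail_range_three :
    ∃ c : ℝ, 0 < c ∧
      ∀ (k : ℕ), 0 < k →
        ∀ (V : Type) [Fintype V] (G : SimpleGraph V), G.chromaticNumber = (k : ℕ∞) →
          ∀ d : ℝ, 1 ≤ d → d ≤ (k : ℝ) ^ ((1 : ℝ)/3) →
            subgraphProb G (1/2) (fun G' => ((G'.chromaticNumber.toNat : ℝ) ≤ d)) ≤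
              Real.exp (-c * k * ((k : ℝ) - d ^ 3) / d ^ 3) := by

  refine ⟨1 / 6, by norm_num, fun k hk V _ G hG d hd hdk => ?_⟩
  have hd0 : 0 < d := by linarith
  have hq : 0 < ⌊d⌋₊ := Nat.floor_pos.2 hd
  have hqd : (⌊d⌋₊ : ℝ) ^ 3 ≤ d ^ 3 := by
    gcongr
    exact Nat.floor_le hd0.le
  have hd3 : d ^ 3 ≤ k := by
    calc d ^ 3 ≤ ((k : ℝ) ^ ((1 : ℝ) / 3)) ^ 3 := by gcongr
      _ = (k : ℝ) := by
        rw [← Real.rpow_natCast, ← Real.rpow_mul (Nat.cast_nonneg k)]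
        norm_num
  have hqk : ⌊d⌋₊ ^ 3 ≤ k := by exact_mod_cast hqd.trans hd3
  have hq0 : (0 : ℝ) < (⌊d⌋₊ : ℝ) ^ 3 := by positivity
  have hmissed : (k : ℝ) * (k - d ^ 3) / (2 * d ^ 3) ≤
      (k : ℝ) * (k - (⌊d⌋₊ : ℝ) ^ 3) / (2 * (⌊d⌋₊ : ℝ) ^ 3) := by
    have h₀ := sub_nonneg.2 hd3
    have h₁ := sub_nonneg.2 (hqd.trans hd3)
    gcongr
  have hevent : (fun H : SimpleGraph V => (H.chromaticNumber.toNat : ℝ) ≤ d) =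
      fun H => H.Colorable ⌊d⌋₊ :=
    funext fun H => propext (chromaticNumber_toNat_le_iff_colorable_floor H hd0.le)
  rw [hevent]
  refine (subgraphProb_half_le_of_uncovered G (fun _ _ h => SimpleGraph.Colorable.mono_left h)
    fun R S T hR hS hT => hmissed.trans
      (le_card_edgeFinset_sdiff_of_colorable G hG hq hqk hR hS hT)).trans_eq ?_
  congr 1
  field_simp
  ring
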